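/- Let N ≥ 3 be odd, q ∈ ℂ a primitive N-th root of unity, and let X, Z be invertible N×N complex matrices with Z·X = q·X·Z and X^N = Z^N = 1. Let x_r, y_r, μ_r, x_s, y_s, μ_s, κ₀, κ₁ be nonzero complex numbers, c₀ ∈ ℂ with c₀² = q² x_r x_s/(y_r y_s), z_s ∈ ℂ nonzero with z_s² = κ₀κ₁ x_s y_s, and d_s := κ₀ y_s/(z_s q). For ν ∈ {1, q, q⁻¹} define the N×N matrices Ω_ν(e₀) := (κ₀ x_r/(q−q⁻¹))·X⁻¹·((ν y_s/(x_r μ_r ν μ_s))·Z⁻² − 1), Ω_ν(e₁) := (κ₁ y_r/(q−q⁻¹))·((ν x_s μ_r ν μ_s/y_r)·Z² − 1)·X, Ω_ν(t₀) := (c₀ y_r ν y_s/(q² x_r ν x_s μ_r ν μ_s))·Z⁻², Ω_ν(t₁) := Ω_ν(t₀)⁻¹ (i.e. the parameters (x_s,y_s,μ_s) are replaced by (ν x_s, ν y_s, ν μ_s)), and write Ω := Ω_1. Let π(e₀) := [[0,0],[z_s,0]], π(e₁) := [[0,z_s],[0,0]], π(t₀) := diag(q⁻¹,q), π(t₁)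 := diag(q,q⁻¹). Define Ī : ℂ^N → ℂ^N ⊗ ℂ² by Ī(v) := (d_s v) ⊗ u₀ + (X v) ⊗ u₁ and T̄ : ℂ^N ⊗ ℂ² → ℂ^N by T̄(w ⊗ u₀) := −X w, T̄(w ⊗ u₁) := d_s w. Then: (a) (Ω(e₀) ⊗ 1₂ + c₀·Ω(t₀) ⊗ π(e₀))∘Ī = Ī∘Ω_q(e₀), (Ω(e₁) ⊗ 1₂ + c₀⁻¹·Ω(t₁) ⊗ π(e₁))∘Ī = Ī∘Ω_q(e₁), and (Ω(t_i) ⊗ π(t_i))∘Ī = Ī∘Ω_q(t_i) for i = 0, 1; (b) T̄∘(Ω(e₀) ⊗ 1₂ + c₀·Ω(t₀) ⊗ π(e₀)) = Ω_{q⁻¹}(e₀)∘T̄, T̄∘(Ω(e₁) ⊗ 1₂ + c₀⁻¹·Ω(t₁) ⊗ π(e₁)) = Ω_{q⁻¹}(e₁)∘T̄, and T̄∘(Ω(t_i) ⊗ π(t_i)) = Ω_{q⁻¹}(t_i)∘T̄ for i = 0, 1; (c) Ī is injective, T̄ is surjective, and the kernel of T̄ equals the range of Ī. -/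

import Mathlib

open Matrix Kronecker

namespace Matrix

variable {n m R : Type*} [CommRing R]

/-- The matrix of a map into `Rᵐ ⊗ R²` with components `A` and `B` along the basis of `R²`. -/
def tensorCol (A B : Matrix n m R) : Matrix (n × Fin 2) m R :=
  of fun p j => if p.2 = 0 then A p.1 j else B p.1 j

/-- The matrix of a map out of `Rᵐ ⊗ R²` with components `A` and `B` along the basis of `R²`. -/
def tensorRow (A B : Matrix m n R) : Matrix m (n × Fin 2) R :=
  of fun i p => if p.2 = 0 then A i p.1 else B i p.1

theorem tensorCol_add (A B A' B' : Matrix n m R) :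
    tensorCol A B + tensorCol A' B' = tensorCol (A + A') (B + B') := by
  ext ⟨i, k⟩ j
  fin_cases k <;> simp [tensorCol]

theorem smul_tensorCol (c : R) (A B : Matrix n m R) :
    c • tensorCol A B = tensorCol (c • A) (c • B) := by
  ext ⟨i, k⟩ j
  fin_cases k <;> simp [tensorCol]

theorem tensorRow_add (A B A' B' : Matrix m n R) :
    tensorRow A B + tensorRow A' B' = tensorRow (A + A') (B + B') := by
  ext i ⟨j, k⟩
  fin_cases k <;> simp [tensorRow]

theorem smul_tensorRow (c : R) (A B : Matrix m n R) :
    c • tensorRow A B = tensorRow (c • A) (c • B) := by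
  ext i ⟨j, k⟩
  fin_cases k <;> simp [tensorRow]

theorem tensorCol_mul {l : Type*} [Fintype m] (A B : Matrix n m R) (C : Matrix m l R) :
    tensorCol A B * C = tensorCol (A * C) (B * C) := by
  ext ⟨i, k⟩ j
  fin_cases k <;> simp [tensorCol, mul_apply]

theorem mul_tensorRow {l : Type*} [Fintype m] (A B : Matrix m n R) (C : Matrix l m R) :
    C * tensorRow A B = tensorRow (C * A) (C * B) := by
  ext i ⟨j, k⟩
  fin_cases k <;> simp [tensorRow, mul_apply]

theorem kronecker_mul_tensorCol [Fintype n] (P : Matrix n n R) (p : Matrix (Fin 2) (Fin 2) R)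
    (A B : Matrix n m R) :
    (P ⊗ₖ p) * tensorCol A B =
      tensorCol (p 0 0 • (P * A) + p 0 1 • (P * B)) (p 1 0 • (P * A) + p 1 1 • (P * B)) := by
  ext ⟨i, k⟩ j
  fin_cases k <;>
    simp [tensorCol, mul_apply, Fintype.sum_prod_type, Finset.sum_add_distrib,
      Finset.mul_sum, mul_assoc, mul_left_comm]

theorem tensorRow_mul_kronecker [Fintype n] (P : Matrix n n R) (p : Matrix (Fin 2) (Fin 2) R)
    (A B : Matrix m n R) :
    tensorRow A B * (P ⊗ₖ p) =
      tensorRow (p 0 0 • (A * P) + p 1 0 • (B * P)) (p 0 1 • (A * P) + p 1 1 • (B * P)) := by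
  ext i ⟨j, k⟩
  fin_cases k <;>
    simp [tensorRow, mul_apply, Fintype.sum_prod_type, Finset.sum_add_distrib,
      Finset.mul_sum, mul_assoc, mul_comm, mul_left_comm]

theorem tensorRow_mul_tensorCol {l : Type*} [Fintype n] (A B : Matrix m n R)
    (C D : Matrix n l R) :
    tensorRow A B * tensorCol C D = A * C + B * D := by
  ext i j
  simp [tensorRow, tensorCol, mul_apply, Fintype.sum_prod_type, Finset.sum_add_distrib]

theorem tensorCol_mul_tensorRow_add_eq_one [Fintype n] [DecidableEq n] (d e : R) (h : d * e = 1)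
    (X : Matrix n n R) :
    tensorCol (d • (1 : Matrix n n R)) X * tensorRow (e • (1 : Matrix n n R)) 0 +
        tensorCol 0 (e • (1 : Matrix n n R)) * tensorRow (-X) (d • (1 : Matrix n n R)) = 1 := by
  ext ⟨i, k⟩ ⟨j, l⟩
  fin_cases k <;> fin_cases l <;>
    simp [tensorCol, mul_apply, tensorRow, one_apply, Prod.ext_iff, h, mul_comm e d, mul_comm]

/-- A split complex of matrices is short exact. -/
theorem exact_mulVecLin_of_splitting {l : Type*} [Fintype l] [Fintype m] [Fintype n]
    [DecidableEq l] [DecidableEq m] [DecidableEq n]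
    {I : Matrix m l R} {T : Matrix n m R} {L : Matrix l m R} {S : Matrix m n R}
    (hTI : T * I = 0) (hLI : L * I = 1) (hTS : T * S = 1) (h : I * L + S * T = 1) :
    Function.Injective I.mulVecLin ∧ Function.Surjective T.mulVecLin ∧
      LinearMap.ker T.mulVecLin = LinearMap.range I.mulVecLin := by
  refine ⟨Function.LeftInverse.injective (g := L.mulVecLin) fun v => ?_,
    Function.RightInverse.surjective (g := S.mulVecLin) fun v => ?_, ?_⟩
  · simp [hLI]
  · simp [hTS]
  · ext v
    simp only [LinearMap.mem_ker, LinearMap.mem_range, mulVecLin_apply]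
    constructor
    · intro hv
      refine ⟨L *ᵥ v, ?_⟩
      have := congrArg (· *ᵥ v) h
      simpa [add_mulVec, ← mulVec_mulVec, hv] using this
    · rintro ⟨w, rfl⟩
      simp [hTI]

theorem sq_mul_of_mul_eq_smul [Fintype n] [DecidableEq n] {q : R} {X Z : Matrix n n R}
    (h : Z * X = q • (X * Z)) : Z ^ 2 * X = q ^ 2 • (X * Z ^ 2) := by
  rw [pow_two, Matrix.mul_assoc, h, Matrix.mul_smul, ← Matrix.mul_assoc, h, smul_mul, smul_smul,
    Matrix.mul_assoc, pow_two]

end Matrix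

/-- Short exact sequence `0 → Ω_{r,sq} → Ω_{r,s} ⊗ π_{z_s} → Ω_{r,sq⁻¹} → 0` of
`U_q(b₊)`-representations (Theorem SESs (iii)). -/
theorem stmt_9 (N : ℕ) (hN : 3 ≤ N) (hNodd : Odd N)
    (q : ℂ) (hq : IsPrimitiveRoot q N)
    (X Z : Matrix (Fin N) (Fin N) ℂ) (hXu : IsUnit X) (hZu : IsUnit Z)
    (hZX : Z * X = q • (X * Z)) (hXN : X ^ N = 1) (hZN : Z ^ N = 1)
    (xr yr μr xs ys μs κ₀ κ₁ : ℂ)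
    (hxr : xr ≠ 0) (hyr : yr ≠ 0) (hμr : μr ≠ 0)
    (hxs : xs ≠ 0) (hys : ys ≠ 0) (hμs : μs ≠ 0) (hκ₀ : κ₀ ≠ 0) (hκ₁ : κ₁ ≠ 0)
    (c₀ : ℂ) (hc₀ : c₀ ^ 2 = q ^ 2 * xr * xs / (yr * ys))
    (zs : ℂ) (hzs : zs ^ 2 = κ₀ * κ₁ * xs * ys) (hzs0 : zs ≠ 0)
    (ds : ℂ) (hds : ds = κ₀ * ys / (zs * q))
    (Ωe₀ Ωe₁ Ωt₀ Ωt₁ : ℂ → Matrix (Fin N) (Fin N) ℂ)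
    (hΩe₀ : ∀ ν, Ωe₀ ν = (κ₀ * xr / (q - q⁻¹)) •
      (X⁻¹ * ((ν * ys / (xr * μr * (ν * μs))) • (Z⁻¹) ^ 2 - 1)))
    (hΩe₁ : ∀ ν, Ωe₁ ν = (κ₁ * yr / (q - q⁻¹)) •
      (((ν * xs * μr * (ν * μs) / yr) • Z ^ 2 - 1) * X))
    (hΩt₀ : ∀ ν, Ωt₀ ν = (c₀ * yr * (ν * ys) /
      (q ^ 2 * xr * (ν * xs) * μr * (ν * μs))) • (Z⁻¹) ^ 2)
    (hΩt₁ : ∀ ν, Ωt₁ ν = (Ωt₀ ν)⁻¹)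
    (πe₀ πe₁ πt₀ πt₁ : Matrix (Fin 2) (Fin 2) ℂ)
    (hπe₀ : πe₀ = !![0, 0; zs, 0]) (hπe₁ : πe₁ = !![0, zs; 0, 0])
    (hπt₀ : πt₀ = !![q⁻¹, 0; 0, q]) (hπt₁ : πt₁ = !![q, 0; 0, q⁻¹])
    (Ibar : Matrix (Fin N × Fin 2) (Fin N) ℂ)
    (hIbar : Ibar = Matrix.of fun p j =>
      if p.2 = 0 then (ds • (1 : Matrix (Fin N) (Fin N) ℂ)) p.1 j else X p.1 j)
    (Tbar : Matrix (Fin N) (Fin N × Fin 2) ℂ)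
    (hTbar : Tbar = Matrix.of fun i p =>
      if p.2 = 0 then (-X) i p.1 else (ds • (1 : Matrix (Fin N) (Fin N) ℂ)) i p.1) :
    -- (a) Ī intertwines Ω_{r,sq} with Ω_{r,s} ⊗ π_{z_s}
    ((Ωe₀ 1 ⊗ₖ (1 : Matrix (Fin 2) (Fin 2) ℂ) + c₀ • (Ωt₀ 1 ⊗ₖ πe₀)) * Ibar
        = Ibar * Ωe₀ q ∧
      (Ωe₁ 1 ⊗ₖ (1 : Matrix (Fin 2) (Fin 2) ℂ) + c₀⁻¹ • (Ωt₁ 1 ⊗ₖ πe₁)) * Ibar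
        = Ibar * Ωe₁ q ∧
      (Ωt₀ 1 ⊗ₖ πt₀) * Ibar = Ibar * Ωt₀ q ∧
      (Ωt₁ 1 ⊗ₖ πt₁) * Ibar = Ibar * Ωt₁ q) ∧
    -- (b) T̄ intertwines Ω_{r,s} ⊗ π_{z_s} with Ω_{r,sq⁻¹}
    (Tbar * (Ωe₀ 1 ⊗ₖ (1 : Matrix (Fin 2) (Fin 2) ℂ) + c₀ • (Ωt₀ 1 ⊗ₖ πe₀))
        = Ωe₀ q⁻¹ * Tbar ∧
      Tbar * (Ωe₁ 1 ⊗ₖ (1 : Matrix (Fin 2) (Fin 2) ℂ) + c₀⁻¹ • (Ωt₁ 1 ⊗ₖ πe₁))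
        = Ωe₁ q⁻¹ * Tbar ∧
      Tbar * (Ωt₀ 1 ⊗ₖ πt₀) = Ωt₀ q⁻¹ * Tbar ∧
      Tbar * (Ωt₁ 1 ⊗ₖ πt₁) = Ωt₁ q⁻¹ * Tbar) ∧
    -- (c) exactness
    (Function.Injective Ibar.mulVecLin ∧ Function.Surjective Tbar.mulVecLin ∧
      LinearMap.ker Tbar.mulVecLin = LinearMap.range Ibar.mulVecLin) := by
  have hq0 : q ≠ 0 := hq.ne_zero (by lia)
  have hq2 : q ^ 2 ≠ 1 := hq.pow_ne_one_of_pos_of_lt (by lia) (by lia)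
  have hqq : q ^ 2 - 1 ≠ 0 := sub_ne_zero.mpr hq2
  have hqi : q - q⁻¹ ≠ 0 := by
    intro h
    apply hqq
    field_simp at h
    simpa using h
  have hc : c₀ ^ 2 * (yr * ys) = q ^ 2 * xr * xs := by
    rw [hc₀]; field_simp
  have hc0 : c₀ ≠ 0 := by
    rintro rfl
    have : q ^ 2 * xr * xs ≠ 0 := by positivity
    exact this (by simpa using hc.symm)
  have hd0 : ds ≠ 0 := by rw [hds]; positivity
  have hXd : IsUnit X.det := (isUnit_iff_isUnit_det X).mp hXu
  have hZd : IsUnit Z.det := (isUnit_iff_isUnit_det Z).mp hZu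
  have hYX : X⁻¹ * X = 1 := nonsing_inv_mul X hXd
  have hXY : X * X⁻¹ = 1 := mul_nonsing_inv X hXd
  have hWZ : Z⁻¹ * Z = 1 := nonsing_inv_mul Z hZd
  have hWX : Z⁻¹ * X = q⁻¹ • (X * Z⁻¹) := by
    have h := congrArg (fun M => q⁻¹ • (Z⁻¹ * M * Z⁻¹)) hZX
    simp only [Matrix.mul_smul, Matrix.smul_mul, smul_smul, inv_mul_cancel₀ hq0, one_smul,
      ← Matrix.mul_assoc, hWZ, Matrix.one_mul] at h
    rw [Matrix.mul_assoc (Z⁻¹ * X), mul_nonsing_inv Z hZd, Matrix.mul_one] at h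
    exact h.symm
  have hZ2X := sq_mul_of_mul_eq_smul hZX
  have hW2X := sq_mul_of_mul_eq_smul hWX
  have hWZ2 : (Z⁻¹) ^ 2 * Z ^ 2 = 1 := by
    rw [pow_two, pow_two, Matrix.mul_assoc, ← Matrix.mul_assoc Z⁻¹ Z, hWZ, Matrix.one_mul, hWZ]
  clear hN hNodd hXu hZu hXN hZN hZX hXd hZd hWX hWZ
  generalize (Z⁻¹) ^ 2 = W2 at hΩe₀ hΩt₀ hW2X hWZ2
  generalize Z ^ 2 = Z2 at hΩe₁ hZ2X hWZ2
  generalize X⁻¹ = Y at hΩe₀ hYX hXY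
  obtain ⟨k, hk⟩ : ∃ k, k = κ₀ * xr / (q - q⁻¹) := ⟨_, rfl⟩
  obtain ⟨k', hk'⟩ : ∃ k', k' = κ₁ * yr / (q - q⁻¹) := ⟨_, rfl⟩
  obtain ⟨b, hb⟩ : ∃ b, b = ys / (xr * μr * μs) := ⟨_, rfl⟩
  obtain ⟨b', hb'⟩ : ∃ b', b' = xs * μr * μs / yr := ⟨_, rfl⟩
  obtain ⟨t, ht⟩ : ∃ t, t = c₀ * yr * ys / (q ^ 2 * xr * xs * μr * μs) := ⟨_, rfl⟩
  have ht0 : t ≠ 0 := by rw [ht]; positivity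
  have he₀ : ∀ ν, ν ≠ 0 → Ωe₀ ν = k • (Y * (b • W2 - 1)) := by
    intro ν hν
    rw [hΩe₀, hk, hb]
    congr 4
    field_simp
  have he₁ : ∀ ν, Ωe₁ ν = k' • (((ν ^ 2 * b') • Z2 - 1) * X) := by
    intro ν
    rw [hΩe₁, hk', hb']
    congr 4
    ring
  have ht₀ : ∀ ν, ν ≠ 0 → Ωt₀ ν = (t * ν⁻¹) • W2 := by
    intro ν hν
    rw [hΩt₀, ht]
    congr 1
    field_simp
  have ht₁ : ∀ ν, ν ≠ 0 → Ωt₁ ν = (t⁻¹ * ν) • Z2 := by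
    intro ν hν
    rw [hΩt₁, ht₀ ν hν]
    apply inv_eq_right_inv
    rw [Matrix.smul_mul, Matrix.mul_smul, hWZ2, smul_smul]
    field_simp
    exact one_smul _ _
  have hkey₀ : c₀ * t * zs * ds = k * b * (1 - q⁻¹ ^ 2) := by
    rw [ht, hds, hk, hb]
    field_simp
    linear_combination hc
  have hkey₁ : c₀⁻¹ * t⁻¹ * zs = ds * k' * b' * (q ^ 2 - 1) := by
    rw [ht, hds, hk', hb']
    field_simp
    linear_combination q ^ 2 * xr * hzs - ys * κ₀ * κ₁ * hc
  have hI : Ibar = tensorCol (ds • 1) X := hIbar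
  have hT : Tbar = tensorRow (-X) (ds • 1) := hTbar
  obtain ⟨E, hE⟩ : ∃ E, E = k • (Y * (b • W2 - 1)) := ⟨_, rfl⟩
  have hEX : E * X + (c₀ * t * zs * ds) • W2 = X * E := by
    rw [hkey₀, hE]
    simp only [Matrix.mul_assoc, Matrix.sub_mul, Matrix.mul_sub, Matrix.smul_mul,
      Matrix.mul_smul, hW2X, Matrix.mul_one, hYX, hXY]
    simp only [← Matrix.mul_assoc, hYX, hXY, Matrix.one_mul]
    module
  have hXe₁ : ∀ ν, X * Ωe₁ (q * ν) = Ωe₁ ν * X := by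
    intro ν
    rw [he₁, he₁]
    simp only [Matrix.mul_assoc, Matrix.sub_mul, Matrix.mul_sub, Matrix.smul_mul,
      Matrix.mul_smul, hZ2X, Matrix.one_mul]
    module
  have hde₁ : ∀ ν, ds • Ωe₁ (q * ν) = ds • Ωe₁ ν + (c₀⁻¹ * t⁻¹ * zs * ν ^ 2) • (Z2 * X) := by
    intro ν
    rw [he₁, he₁, hkey₁]
    simp only [Matrix.sub_mul, Matrix.smul_mul, Matrix.one_mul]
    module
  have hXe₁q : X * Ωe₁ q = Ωe₁ 1 * X := by simpa using hXe₁ 1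
  have hXe₁1 : X * Ωe₁ 1 = Ωe₁ q⁻¹ * X := by simpa [hq0] using hXe₁ q⁻¹
  have hde₁q : ds • Ωe₁ q = ds • Ωe₁ 1 + (c₀⁻¹ * t⁻¹ * zs) • (Z2 * X) := by simpa using hde₁ 1
  have hde₁1 : ds • Ωe₁ 1 = ds • Ωe₁ q⁻¹ + (c₀⁻¹ * t⁻¹ * zs) • (X * Z2) := by
    simpa [hq0, hZ2X, smul_smul] using hde₁ q⁻¹
  rw [← hE] at he₀
  rw [hI, hT, he₀ 1 one_ne_zero, he₀ q hq0, he₀ _ (inv_ne_zero hq0),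
    ht₀ 1 one_ne_zero, ht₀ q hq0, ht₀ _ (inv_ne_zero hq0),
    ht₁ 1 one_ne_zero, ht₁ q hq0, ht₁ _ (inv_ne_zero hq0), hπe₀, hπe₁, hπt₀, hπt₁]
  refine ⟨⟨?_, ?_, ?_, ?_⟩, ⟨?_, ?_, ?_, ?_⟩,
    exact_mulVecLin_of_splitting (L := tensorRow (ds⁻¹ • 1) 0) (S := tensorCol 0 (ds⁻¹ • 1))
      ?_ ?_ ?_ (tensorCol_mul_tensorRow_add_eq_one ds ds⁻¹ (mul_inv_cancel₀ hd0) X)⟩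
  · simp only [Matrix.add_mul, Matrix.smul_mul, kronecker_mul_tensorCol, tensorCol_mul,
      smul_tensorCol, tensorCol_add]
    congr 1
    · simp
    · simp
      rw [← hEX]
      module
  · simp only [Matrix.add_mul, Matrix.smul_mul, kronecker_mul_tensorCol, tensorCol_mul,
      smul_tensorCol, tensorCol_add]
    congr 1
    · simp
      rw [hde₁q]
      module
    · simp [hXe₁q]
  · simp only [kronecker_mul_tensorCol, tensorCol_mul]
    congr 1
    · simp
      module
    · simp [hW2X, smul_smul]
      field_simp
  · simp only [kronecker_mul_tensorCol, tensorCol_mul]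
    congr 1
    · simp
      module
    · simp [hZ2X, smul_smul]
      field_simp
  · simp only [Matrix.mul_add, Matrix.mul_smul, tensorRow_mul_kronecker, mul_tensorRow,
      smul_tensorRow, tensorRow_add]
    congr 1
    · simp
      rw [← hEX]
      module
    · simp
  · simp only [Matrix.mul_add, Matrix.mul_smul, tensorRow_mul_kronecker, mul_tensorRow,
      smul_tensorRow, tensorRow_add]
    congr 1
    · simp [hXe₁1]
    · simp
      rw [hde₁1]
      module
  · simp only [tensorRow_mul_kronecker, mul_tensorRow]
    congr 1
    · simp [hW2X, smul_smul]
      field_simp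
    · simp
      module
  · simp only [tensorRow_mul_kronecker, mul_tensorRow]
    congr 1
    · simp [hZ2X, smul_smul]
      field_simp
    · simp
      module
  · simp [tensorRow_mul_tensorCol]
  · simp [tensorRow_mul_tensorCol, smul_smul, hd0]
  · simp [tensorRow_mul_tensorCol, smul_smul, hd0]
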